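/- arXiv:1712.05258 — 6 statements merged into one kernel-verified Lean document; each statement's English description precedes it below -/
import Mathlib

section
/- Let q be a prime power and n ≥ 1 an integer. There exists a transitive affine transformation of F_q^n, i.e. a map x ↦ Ax + b with A ∈ GL_n(F_q) and b ∈ F_q^n such that every point of F_q^n occurs among its iterates of any starting point, if and only if either n = 1 and q is prime, or n = 2 and q = 2. -/
def IsTransitiveMap {X : Type*} (f : X → X) : Prop :=
  ∀ x y : X, ∃ i : ℕ, f^[i] x = y

theorem IsTransitiveMap.minimalPeriod_eq_card {X : Type*} [Fintype X] {f : X → X}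
    (hf : IsTransitiveMap f) (x : X) : Function.minimalPeriod f x = Fintype.card X := by
  have hpos : 0 < Function.minimalPeriod f x := by
    obtain ⟨i, hi⟩ := hf (f x) x
    exact Function.IsPeriodicPt.minimalPeriod_pos (n := i + 1) i.succ_pos hi
  rw [← Fintype.card_fin (Function.minimalPeriod f x)]
  refine Fintype.card_of_bijective (f := fun i : Fin _ => f^[i] x) ⟨fun i j hij => ?_, fun y => ?_⟩
  · exact Fin.ext (Function.iterate_injOn_Iio_minimalPeriod i.2 j.2 hij)
  · obtain ⟨i, rfl⟩ := hf x y
    exact ⟨⟨i % Function.minimalPeriod f x, Nat.mod_lt _ hpos⟩,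
      Function.iterate_mod_minimalPeriod_eq⟩

section Homogenization

variable {F V : Type*} [Field F] [AddCommGroup V] [Module F V]

/-- The linear endomorphism `(v, c) ↦ (φ v + c • b, c)` of `V × F`, which restricts to the affine
map `v ↦ φ v + b` on the hyperplane `c = 1`. -/
def homogenization (φ : V →ₗ[F] V) (b : V) : Module.End F (V × F) :=
  (φ.coprod (LinearMap.toSpanSingleton F V b)).prod (LinearMap.snd F V F)

theorem homogenization_pow_apply_one (φ : V →ₗ[F] V) (b v : V) (i : ℕ) :
    (homogenization φ b ^ i) (v, 1) = ((fun x => φ x + b)^[i] v, 1) := by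
  induction i with
  | zero => rfl
  | succ i ih =>
    rw [pow_succ', Module.End.mul_apply, ih, Function.iterate_succ_apply']
    simp [homogenization]

theorem homogenization_pow_eq_one_iff (φ : V →ₗ[F] V) (b : V) (i : ℕ) :
    homogenization φ b ^ i = 1 ↔ ∀ v, (fun x => φ x + b)^[i] v = v := by
  refine ⟨fun h v => ?_, fun h => ?_⟩
  · have := homogenization_pow_apply_one φ b v i
    rw [h] at this
    exact (congrArg Prod.fst this).symm
  · have h1 (v : V) : (homogenization φ b ^ i) (v, 1) = (v, 1) := by
      rw [homogenization_pow_apply_one, h]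
    refine LinearMap.ext fun ⟨v, c⟩ => ?_
    have hvc : ((v, c) : V × F) = (v, 1) - (0, 1) + c • (0, 1) := by simp
    rw [hvc, map_add, map_sub, map_smul, h1, h1, Module.End.one_apply]

variable [Fintype F] [Fintype V]

theorem IsTransitiveMap.card_le_of_finrank_lt {φ : V →ₗ[F] V} {b : V}
    (hf : IsTransitiveMap fun x => φ x + b) (p : ℕ) [Fact p.Prime] [CharP F p] {k : ℕ}
    (hk : Module.finrank F V < p ^ k) : Fintype.card V ≤ p ^ k := by
  have : CharP (Module.End F (V × F)) p :=
    charP_of_injective_algebraMap (algebraMap F (Module.End F (V × F))).injective p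
  set g := homogenization φ b
  have hpow (j : ℕ) : (g - 1) ^ p ^ j = g ^ p ^ j - 1 := by
    rw [sub_pow_char_pow_of_commute _ _ (Commute.one_right g), one_pow]
  obtain ⟨m, hm⟩ : ∃ m, Fintype.card V = p ^ m := by
    obtain ⟨e, -, he⟩ := FiniteField.card F p
    exact ⟨e * Module.finrank F V, by rw [Module.card_eq_pow_finrank (K := F), he, pow_mul]⟩
  have hnil : IsNilpotent (g - 1) := by
    refine ⟨p ^ m, ?_⟩
    rw [hpow, sub_eq_zero, homogenization_pow_eq_one_iff, ← hm]
    intro v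
    rw [← hf.minimalPeriod_eq_card v, Function.iterate_minimalPeriod]
  have hzero : (g - 1) ^ Module.finrank F (V × F) = 0 := by
    have := LinearMap.aeval_self_charpoly (g - 1)
    rwa [hnil.charpoly_eq_X_pow_finrank, map_pow, Polynomial.aeval_X] at this
  have hone : g ^ p ^ k = 1 := by
    rw [← sub_eq_zero, ← hpow]
    refine pow_eq_zero_of_le ?_ hzero
    rw [Module.finrank_prod, Module.finrank_self]
    exact hk
  rw [homogenization_pow_eq_one_iff] at hone
  rw [← hf.minimalPeriod_eq_card 0]
  exact Function.IsPeriodicPt.minimalPeriod_le (pow_pos (Fact.out : p.Prime).pos k) (hone 0)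

end Homogenization

theorem exists_add_natCast_eq_of_prime_card {F : Type*} [Field F] [Fintype F]
    (hF : (Fintype.card F).Prime) : ∀ x y : F, ∃ i : ℕ, x + i = y := by
  intro x y
  have := Fact.mk hF
  have hb := (ZMod.ringEquivOfPrime F hF rfl).surjective (y - x)
  obtain ⟨a, ha⟩ := hb
  refine ⟨a.val, ?_⟩
  rw [← ZMod.natCast_zmod_val a, map_natCast] at ha
  rw [ha, add_sub_cancel]

theorem exists_transitive_affine_one {F : Type*} [Field F] [Fintype F]
    (hF : (Fintype.card F).Prime) :
    ∃ (A : Matrix.GeneralLinearGroup (Fin 1) F) (b : Fin 1 → F),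
      IsTransitiveMap fun x : Fin 1 → F => (A : Matrix (Fin 1) (Fin 1) F).mulVec x + b := by
  refine ⟨1, 1, fun x y => ?_⟩
  obtain ⟨i, hi⟩ := exists_add_natCast_eq_of_prime_card hF (x 0) (y 0)
  refine ⟨i, ?_⟩
  have : (fun x : Fin 1 → F =>
      ((1 : Matrix.GeneralLinearGroup (Fin 1) F) : Matrix (Fin 1) (Fin 1) F).mulVec x + 1) =
      fun x => x + 1 := by
    funext x; simp
  rw [this, add_right_iterate]
  ext j
  rw [Subsingleton.elim j 0, ← hi]
  simp

theorem exists_transitive_affine_two {F : Type*} [Field F] [Fintype F]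
    (hF : Fintype.card F = 2) :
    ∃ (A : Matrix.GeneralLinearGroup (Fin 2) F) (b : Fin 2 → F),
      IsTransitiveMap fun x : Fin 2 → F => (A : Matrix (Fin 2) (Fin 2) F).mulVec x + b := by
  have h01 (x : F) : x = 0 ∨ x = 1 := by
    obtain ⟨i, hi⟩ := exists_add_natCast_eq_of_prime_card (hF ▸ Nat.prime_two) 0 x
    have h2 : (2 : F) = 0 := by exact_mod_cast hF ▸ FiniteField.cast_card_eq_zero F
    obtain ⟨k, rfl | rfl⟩ := i.even_or_odd'
    · left; simp [← hi, h2]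
    · right; simp [← hi, h2]
  have h11 : (1 : F) + 1 = 0 := (h01 (1 + 1)).resolve_right (by simp)
  refine ⟨Matrix.GeneralLinearGroup.mkOfDetNeZero !![1, 1; 0, 1] (by simp [Matrix.det_fin_two]),
    ![0, 1], fun x y => ?_⟩
  have hstep : (fun x : Fin 2 → F => ((Matrix.GeneralLinearGroup.mkOfDetNeZero !![(1 : F), 1; 0, 1]
      (by simp [Matrix.det_fin_two]) : Matrix.GeneralLinearGroup (Fin 2) F) :
      Matrix (Fin 2) (Fin 2) F).mulVec x + ![0, 1]) = fun x => ![x 0 + x 1, x 1 + 1] := by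
    funext x
    ext i
    fin_cases i <;> simp [Matrix.GeneralLinearGroup.mkOfDetNeZero, dotProduct]
  rw [hstep]
  obtain ⟨a, b, rfl⟩ : ∃ a b, x = ![a, b] := ⟨x 0, x 1, by ext i; fin_cases i <;> rfl⟩
  obtain ⟨c, d, rfl⟩ : ∃ a b, y = ![a, b] := ⟨y 0, y 1, by ext i; fin_cases i <;> rfl⟩
  rcases h01 a with rfl | rfl <;> rcases h01 b with rfl | rfl <;>
    rcases h01 c with rfl | rfl <;> rcases h01 d with rfl | rfl <;>
    first
    | (refine ⟨0, ?_⟩; simp; done)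
    | (refine ⟨1, ?_⟩; simp [h11]; done)
    | (refine ⟨2, ?_⟩; simp [h11]; done)
    | (refine ⟨3, ?_⟩; simp [h11])

/-- There is a transitive affine transformation of `F_q^n` iff `n = 1` and `q` is prime,
or `n = 2` and `q = 2`. -/
theorem statement0 {F : Type*} [Field F] [Fintype F] (n : ℕ) (hn : 1 ≤ n) :
    (∃ (A : Matrix.GeneralLinearGroup (Fin n) F) (b : Fin n → F),
        IsTransitiveMap fun x : Fin n → F => (A : Matrix (Fin n) (Fin n) F).mulVec x + b) ↔
      (n = 1 ∧ Nat.Prime (Fintype.card F)) ∨ (n = 2 ∧ Fintype.card F = 2) := by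
  constructor
  · rintro ⟨A, b, hf⟩
    obtain ⟨p, hchar⟩ := CharP.exists F
    obtain ⟨e, hp, he⟩ := FiniteField.card F p
    have := Fact.mk hp
    have hlt := Nat.lt_pow_succ_log_self hp.one_lt n
    have hle := IsTransitiveMap.card_le_of_finrank_lt
      (φ := Matrix.mulVecLin (A : Matrix (Fin n) (Fin n) F)) (b := b) hf p
      (k := Nat.log p n + 1) (by simpa using hlt)
    have hnp : p ^ (Nat.log p n + 1) ≤ n * p := by
      rw [pow_succ]
      exact Nat.mul_le_mul_right p (Nat.pow_log_le_self p (by lia))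
    have hcard : Fintype.card F ^ n ≤ n * p := by
      simpa using hle.trans hnp
    have hpq : p ≤ Fintype.card F := he ▸ Nat.le_self_pow e.ne_zero p
    have hp2 := hp.two_le
    rcases (by lia : n = 1 ∨ n = 2 ∨ 3 ≤ n) with rfl | rfl | h3
    · left
      refine ⟨rfl, ?_⟩
      rw [pow_one, one_mul] at hcard
      rwa [le_antisymm hcard hpq]
    · right
      exact ⟨rfl, by nlinarith⟩
    · exfalso
      have h1 : p ^ (n - 1) * p ≤ n * p := by
        rw [← pow_succ, Nat.sub_add_cancel hn]
        exact (Nat.pow_le_pow_left hpq n).trans hcard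
      have h2 : 2 ^ (n - 1) ≤ n :=
        (Nat.pow_le_pow_left hp2 _).trans (Nat.le_of_mul_le_mul_right h1 hp.pos)
      obtain ⟨m, rfl⟩ := Nat.exists_eq_add_of_le' h3
      have h4 : m < 2 ^ m := Nat.lt_two_pow_self
      have h5 : 2 ^ (m + 3 - 1) = 4 * 2 ^ m := by rw [show m + 3 - 1 = m + 2 from rfl]; ring
      lia
  · rintro (⟨rfl, hF⟩ | ⟨rfl, hF⟩)
    · exact exists_transitive_affine_one hF
    · exact exists_transitive_affine_two hF
end

section
/- Let Ψ be an automorphism of ℙⁿ over F_q and let ψ be its fractional jump. If Ψ acts transitively on ℙⁿ, then ψ acts transitively on F_qⁿ. -/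
open Polynomial

noncomputable def projMap {F : Type*} [Field F] {n : ℕ}
    (M : (Fin (n + 1) → F) ≃ₗ[F] (Fin (n + 1) → F)) :
    Projectivization F (Fin (n + 1) → F) → Projectivization F (Fin (n + 1) → F) :=
  Projectivization.map M.toLinearMap M.injective

/-- `P` lies in the affine chart `U = {Xₙ ≠ 0}`. -/
noncomputable def inU {F : Type*} [Field F] {n : ℕ}
    (P : Projectivization F (Fin (n + 1) → F)) : Prop :=
  P.rep (Fin.last n) ≠ 0

noncomputable def toProj {F : Type*} [Field F] {n : ℕ} (x : Fin n → F) :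
    Projectivization F (Fin (n + 1) → F) :=
  Projectivization.mk F (Fin.snoc x 1) (by
    intro h
    simpa using congrFun h (Fin.last n))

noncomputable def toAff {F : Type*} [Field F] {n : ℕ}
    (P : Projectivization F (Fin (n + 1) → F)) : Fin n → F :=
  fun i => P.rep i.castSucc / P.rep (Fin.last n)

noncomputable def jumpIndex {F : Type*} [Field F] {n : ℕ}
    (Ψ : Projectivization F (Fin (n + 1) → F) → Projectivization F (Fin (n + 1) → F))
    (P : Projectivization F (Fin (n + 1) → F)) : ℕ :=
  sInf {k : ℕ | 1 ≤ k ∧ inU (Ψ^[k] P)}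

noncomputable def fracJump {F : Type*} [Field F] {n : ℕ}
    (M : (Fin (n + 1) → F) ≃ₗ[F] (Fin (n + 1) → F)) (x : Fin n → F) : Fin n → F :=
  toAff ((projMap M)^[jumpIndex (projMap M) (toProj x)] (toProj x))

def ProjectivelyPrimitive {F : Type*} [Field F] (χ : Polynomial F) : Prop :=
  Irreducible χ ∧
  ∀ (K : Type) [Field K] [Algebra F K], Module.finrank F K = χ.natDegree →
    ∀ α : Kˣ, Polynomial.aeval (α : K) χ = 0 →
      Subgroup.zpowers
        (QuotientGroup.mk (s := (Units.map (algebraMap F K).toMonoidHom).range) α) = ⊤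

noncomputable def ep (p : ℕ) (z : ZMod p) : ℂ :=
  Complex.exp (2 * Real.pi * Complex.I * (z.val : ℂ) / p)

noncomputable def snake {A : Type*} {n : ℕ} (hn : 0 < n)
    (ψ : (Fin n → A) → (Fin n → A)) (x : Fin n → A) (m : ℕ) : A :=
  ψ^[(m - 1) / n] x ⟨(m - 1) % n, Nat.mod_lt _ hn⟩

open scoped Classical in
noncomputable def discrepancy (s N : ℕ) (γ : ℕ → Fin s → ℝ) : ℝ :=
  ⨆ α : Fin s → ℝ, ⨆ β : Fin s → ℝ,
    ⨆ _ : ∀ i, 0 ≤ α i ∧ α i ≤ β i ∧ β i ≤ 1,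
      |(((Finset.range N).filter fun m => ∀ i, α i ≤ γ m i ∧ γ m i < β i).card : ℝ) / N
        - ∏ i, (β i - α i)|

noncomputable def Dsnake {p n : ℕ} (hn : 0 < n)
    (ψ : (Fin n → ZMod p) → (Fin n → ZMod p)) (s N : ℕ) (x : Fin n → ZMod p) : ℝ :=
  discrepancy s N fun m i => ((snake hn ψ x (m + 1 + i)).val : ℝ) / p

noncomputable def DsnakeN {p n : ℕ} (hn : 0 < n)
    (ψ : (Fin n → ZMod p) → (Fin n → ZMod p)) (s N : ℕ) (x : Fin n → ZMod p) : ℝ :=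
  discrepancy (s * n) N fun m i => ((snake hn ψ x (m * n + 1 + i)).val : ℝ) / p

theorem toProj_toAff {F : Type*} [Field F] {n : ℕ}
    {P : Projectivization F (Fin (n + 1) → F)} (hP : inU P) : toProj (toAff P) = P := by
  rw [toProj]
  conv_rhs => rw [← P.mk_rep]
  rw [Projectivization.mk_eq_mk_iff']
  refine ⟨(P.rep (Fin.last n))⁻¹, ?_⟩
  ext j
  refine Fin.lastCases ?_ (fun i => ?_) j
  · simpa using inv_mul_cancel₀ hP
  · simp [toAff, div_eq_inv_mul]

theorem inU_toProj {F : Type*} [Field F] {n : ℕ} (x : Fin n → F) : inU (toProj x) := by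
  intro h
  have hne : (Fin.snoc x 1 : Fin (n + 1) → F) ≠ 0 := fun h => by
    simpa using congrFun h (Fin.last n)
  obtain ⟨a, ha⟩ := Projectivization.exists_smul_eq_mk_rep F _ hne
  have hlast := congrFun ha (Fin.last n)
  rw [show Projectivization.mk F _ hne = toProj x from rfl, h] at hlast
  simp [Units.smul_def] at hlast

theorem toProj_injective {F : Type*} [Field F] {n : ℕ} :
    Function.Injective (toProj : (Fin n → F) → Projectivization F (Fin (n + 1) → F)) := by
  intro x y h
  obtain ⟨a, ha⟩ := (Projectivization.mk_eq_mk_iff' F _ _ _ _).1 h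
  have ha1 : a = 1 := by simpa using congrFun ha (Fin.last n)
  ext i
  simpa [ha1] using (congrFun ha i.castSucc).symm

theorem exists_fracJump_iterate_eq {F : Type*} [Field F] {n : ℕ}
    (M : (Fin (n + 1) → F) ≃ₗ[F] (Fin (n + 1) → F)) (y : Fin n → F) (i : ℕ) :
    ∀ x, (projMap M)^[i] (toProj x) = toProj y → ∃ j, (fracJump M)^[j] x = y := by
  induction i using Nat.strong_induction_on with
  | _ i ih =>
    intro x hx
    rcases Nat.eq_zero_or_pos i with rfl | hi
    · exact ⟨0, toProj_injective hx⟩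
    have hmem : i ∈ {k : ℕ | 1 ≤ k ∧ inU ((projMap M)^[k] (toProj x))} :=
      ⟨hi, hx ▸ inU_toProj y⟩
    have hle : jumpIndex (projMap M) (toProj x) ≤ i := Nat.sInf_le hmem
    obtain ⟨hpos, hU⟩ : 1 ≤ jumpIndex (projMap M) (toProj x) ∧
        inU ((projMap M)^[jumpIndex (projMap M) (toProj x)] (toProj x)) :=
      Nat.sInf_mem ⟨i, hmem⟩
    obtain ⟨j, hj⟩ := ih (i - jumpIndex (projMap M) (toProj x)) (by omega) (fracJump M x) (by
      rw [fracJump, toProj_toAff hU, ← Function.iterate_add_apply, Nat.sub_add_cancel hle, hx])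
    exact ⟨j + 1, hj⟩

/-- If `Ψ` acts transitively on `ℙⁿ`, then its fractional jump `ψ` acts transitively
on `F_qⁿ`. -/
theorem statement2 {F : Type*} [Field F] [Fintype F] (n : ℕ) (hn : 1 ≤ n)
    (M : (Fin (n + 1) → F) ≃ₗ[F] (Fin (n + 1) → F))
    (hM : IsTransitiveMap (projMap M)) :
    IsTransitiveMap (fracJump M) := by
  intro x y
  obtain ⟨i, hi⟩ := hM (toProj x) (toProj y)
  exact exists_fracJump_iterate_eq M y i x hi
end

section
/- Let Ψ be an automorphism of ℙⁿ over F_q, and write Ψ = [M] ∈ PGL_{n+1}(F_q) for some M ∈ GL_{n+1}(F_q). Then Ψ acts transitively on ℙⁿ if and only if the characteristic polynomial χ_M(T) ∈ F_q[T] of M is projectively primitive. -/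
open Polynomial

theorem projMap_iterate_mk {F : Type*} [Field F] {n : ℕ}
    (M : (Fin (n + 1) → F) ≃ₗ[F] (Fin (n + 1) → F)) (i : ℕ) (v : Fin (n + 1) → F) (hv : v ≠ 0)
    (hi : (M.toLinearMap ^ i) v ≠ 0) :
    (projMap M)^[i] (Projectivization.mk F v hv) =
      Projectivization.mk F ((M.toLinearMap ^ i) v) hi := by
  induction i with
  | zero => rfl
  | succ i ih =>
    have h : (M.toLinearMap ^ i) v ≠ 0 := fun h => hi (by rw [pow_succ']; simp [h])
    rw [Function.iterate_succ_apply', ih h, projMap, Projectivization.map_mk]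
    simp only [pow_succ', Module.End.mul_apply]

theorem isTransitiveMap_projMap_iff {F : Type*} [Field F] {n : ℕ}
    (M : (Fin (n + 1) → F) ≃ₗ[F] (Fin (n + 1) → F)) :
    IsTransitiveMap (projMap M) ↔ ∀ v w : Fin (n + 1) → F, v ≠ 0 → w ≠ 0 →
      ∃ (i : ℕ) (c : F), c • (M.toLinearMap ^ i) v = w := by
  have hne (i : ℕ) (v : Fin (n + 1) → F) (hv : v ≠ 0) : (M.toLinearMap ^ i) v ≠ 0 := by
    rw [Module.End.pow_apply]
    exact fun h => hv (M.injective.iterate i (by simpa using h))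
  constructor
  · intro h v w hv hw
    obtain ⟨i, hi⟩ := h (Projectivization.mk F v hv) (Projectivization.mk F w hw)
    rw [projMap_iterate_mk M i v hv (hne i v hv), eq_comm, Projectivization.mk_eq_mk_iff'] at hi
    exact ⟨i, hi⟩
  · intro h x y
    induction x with | h v hv
    induction y with | h w hw
    obtain ⟨i, hi⟩ := h v w hv hw
    refine ⟨i, ?_⟩
    rw [projMap_iterate_mk M i v hv (hne i v hv), eq_comm, Projectivization.mk_eq_mk_iff']
    exact hi

theorem zpowers_mk_eq_top_iff {F K : Type*} [Field F] [Field K] [Algebra F K] [Finite K]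
    (α : Kˣ) :
    Subgroup.zpowers
        (QuotientGroup.mk (s := (Units.map (algebraMap F K).toMonoidHom).range) α) = ⊤ ↔
      ∀ β : K, β ≠ 0 → ∃ (i : ℕ) (c : F), c • (α : K) ^ i = β := by
  rw [Subgroup.eq_top_iff']
  constructor
  · intro h β hβ
    have h1 := h (QuotientGroup.mk (Units.mk0 β hβ))
    rw [← mem_powers_iff_mem_zpowers] at h1
    obtain ⟨i, hi⟩ := h1
    change QuotientGroup.mk (α ^ i) = _ at hi
    rw [QuotientGroup.eq] at hi
    obtain ⟨c, hc⟩ := hi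
    refine ⟨i, c, ?_⟩
    have h2 := congrArg (fun u : Kˣ => (u : K)) (eq_inv_mul_iff_mul_eq.mp hc)
    simpa [Algebra.smul_def, mul_comm] using h2
  · intro h x
    induction x using QuotientGroup.induction_on with | H β
    obtain ⟨i, c, hc⟩ := h β β.ne_zero
    have hc0 : c ≠ 0 := by
      rintro rfl
      exact β.ne_zero (by simpa using hc.symm)
    refine ⟨i, ?_⟩
    change QuotientGroup.mk (α ^ (i : ℤ)) = _
    rw [QuotientGroup.eq]
    refine ⟨Units.mk0 c hc0, eq_inv_mul_of_mul_eq (Units.ext ?_)⟩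
    simpa [Algebra.smul_def, mul_comm] using hc

section Charpoly

variable {F V : Type*} [Field F] [AddCommGroup V] [Module F V] [Module.Finite F V]

/-- The linear map `F[X]/(charpoly f) → V` sending the class of `p` to `p(f) v`. -/
noncomputable def adjoinRootCharpolyToModule (f : Module.End F V) (v : V) :
    AdjoinRoot f.charpoly →ₗ[F] V :=
  LinearMap.applyₗ v ∘ₗ (aeval f).toLinearMap ∘ₗ AdjoinRoot.modByMonicHom f.charpoly_monic

theorem adjoinRootCharpolyToModule_mk (f : Module.End F V) (v : V) (p : F[X]) :
    adjoinRootCharpolyToModule f v (AdjoinRoot.mk f.charpoly p) = aeval f p v := by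
  simp [adjoinRootCharpolyToModule, AdjoinRoot.modByMonicHom_mk,
    aeval_modByMonic_eq_self_of_root f.aeval_self_charpoly]

theorem finrank_adjoinRoot_charpoly (f : Module.End F V) :
    Module.finrank F (AdjoinRoot f.charpoly) = Module.finrank F V := by
  rw [(AdjoinRoot.powerBasis' f.charpoly_monic).finrank, AdjoinRoot.powerBasis'_dim,
    f.charpoly_natDegree]

theorem aeval_apply_surjective_iff (f : Module.End F V) (v : V) :
    (∀ w, ∃ p : F[X], aeval f p v = w) ↔ ∀ p : F[X], aeval f p v = 0 → f.charpoly ∣ p := by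
  have : Module.Finite F (AdjoinRoot f.charpoly) := f.charpoly_monic.finite_adjoinRoot
  have h := LinearMap.injective_iff_surjective_of_finrank_eq_finrank
    (finrank_adjoinRoot_charpoly f) (f := adjoinRootCharpolyToModule f v)
  rw [injective_iff_map_eq_zero] at h
  simpa [Function.Surjective, AdjoinRoot.mk_surjective.forall, AdjoinRoot.mk_surjective.exists,
    adjoinRootCharpolyToModule_mk, AdjoinRoot.mk_eq_zero] using h.symm

theorem irreducible_charpoly_iff [Nontrivial V] (f : Module.End F V) :
    Irreducible f.charpoly ↔ ∀ v : V, v ≠ 0 → ∀ p : F[X], aeval f p v = 0 → f.charpoly ∣ p := by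
  constructor
  · intro h v hv p hp
    by_contra hdvd
    obtain ⟨a, b, hab⟩ := h.coprime_iff_not_dvd.mpr hdvd
    apply hv
    have := congrArg (fun q => aeval f q v) hab
    simpa [f.aeval_self_charpoly, hp] using this.symm
  · intro h
    obtain ⟨v, hv⟩ := exists_ne (0 : V)
    refine Prime.irreducible ⟨f.charpoly_monic.ne_zero, ?_, ?_⟩
    · intro hu
      obtain ⟨b, hb⟩ := isUnit_iff_dvd_one.mp hu
      apply hv
      have := congrArg (fun q => aeval f q v) hb
      simpa [f.aeval_self_charpoly] using this
    · rintro a b ⟨c, hc⟩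
      have hab : aeval f a (aeval f b v) = 0 := by
        rw [← Module.End.mul_apply, ← map_mul, hc]
        simp [f.aeval_self_charpoly]
      by_cases hb : aeval f b v = 0
      · exact Or.inr (h v hv b hb)
      · exact Or.inl (h _ hb a hab)

/-- For a root `α` of the irreducible characteristic polynomial of `f` generating a field of
the right degree, evaluation at `α` identifies orbits of `f` with multiples of powers of `α`. -/
theorem forall_exists_smul_pow_iff [Nontrivial V] (f : Module.End F V)
    (hf : Irreducible f.charpoly) {K : Type*} [Field K] [Algebra F K]
    (hK : Module.finrank F K = f.charpoly.natDegree) {α : K} (hα : aeval α f.charpoly = 0) :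
    (∀ v w : V, v ≠ 0 → w ≠ 0 → ∃ (i : ℕ) (c : F), c • (f ^ i) v = w) ↔
      ∀ β : K, β ≠ 0 → ∃ (i : ℕ) (c : F), c • α ^ i = β := by
  have hmin : minpoly F α = f.charpoly :=
    (minpoly.eq_of_irreducible_of_monic hf hα f.charpoly_monic).symm
  have hK0 : 0 < Module.finrank F K := hK ▸ hf.natDegree_pos
  have : Module.Finite F K := Module.finite_of_finrank_pos hK0
  have hdvd (p : F[X]) : aeval α p = 0 ↔ f.charpoly ∣ p := by
    rw [← hmin, minpoly.dvd_iff]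
  have hdvd' (v : V) (hv : v ≠ 0) (p : F[X]) : aeval f p v = 0 ↔ f.charpoly ∣ p := by
    refine ⟨(irreducible_charpoly_iff f).mp hf v hv p, ?_⟩
    rintro ⟨q, rfl⟩
    simp [f.aeval_self_charpoly]
  have hsurj (β : K) : ∃ p : F[X], aeval α p = β := by
    have htop : IntermediateField.adjoin F {α} = ⊤ :=
      Field.primitive_element_iff_minpoly_natDegree_eq F α |>.mpr (by rw [hmin, hK])
    have hβ : β ∈ Algebra.adjoin F {α} := by
      rw [← IntermediateField.adjoin_simple_toSubalgebra_of_isAlgebraic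
        (Algebra.IsAlgebraic.isAlgebraic α), htop]
      trivial
    rw [Algebra.adjoin_singleton_eq_range_aeval] at hβ
    exact hβ
  have key (v : V) (hv : v ≠ 0) (p : F[X]) (i : ℕ) (c : F) :
      c • (f ^ i) v = aeval f p v ↔ c • α ^ i = aeval α p := by
    have h1 := (hdvd' v hv (C c * X ^ i - p)).trans (hdvd (C c * X ^ i - p)).symm
    simpa [sub_eq_zero, Algebra.smul_def] using h1
  obtain ⟨v₀, hv₀⟩ := exists_ne (0 : V)
  constructor
  · intro h β hβ
    obtain ⟨p, rfl⟩ := hsurj β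
    have hp : aeval f p v₀ ≠ 0 := by rwa [Ne, hdvd' v₀ hv₀, ← hdvd]
    obtain ⟨i, c, hc⟩ := h v₀ _ hv₀ hp
    exact ⟨i, c, (key v₀ hv₀ p i c).mp hc⟩
  · intro h v w hv hw
    obtain ⟨p, rfl⟩ := (aeval_apply_surjective_iff f v).mpr
      ((irreducible_charpoly_iff f).mp hf v hv) w
    have hp : aeval α p ≠ 0 := by rwa [Ne, hdvd, ← hdvd' v hv]
    obtain ⟨i, c, hc⟩ := h _ hp
    exact ⟨i, c, (key v hv p i c).mpr hc⟩

theorem irreducible_charpoly_of_forall_exists_smul_pow [Nontrivial V] (f : Module.End F V)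
    (h : ∀ v w : V, v ≠ 0 → w ≠ 0 → ∃ (i : ℕ) (c : F), c • (f ^ i) v = w) :
    Irreducible f.charpoly := by
  refine (irreducible_charpoly_iff f).mpr fun v hv =>
    (aeval_apply_surjective_iff f v).mp fun w => ?_
  by_cases hw : w = 0
  · exact ⟨0, by simp [hw]⟩
  · obtain ⟨i, c, rfl⟩ := h v w hv hw
    exact ⟨C c * X ^ i, by simp [← Algebra.smul_def]⟩

end Charpoly

/-- Over a finite field, an irreducible polynomial has a root in an extension of the same degree
living in `Type`. -/
theorem exists_root_in_type {F : Type*} [Field F] [Finite F] {χ : F[X]} (h : Irreducible χ) :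
    ∃ (K : Type) (_ : Field K) (_ : Algebra F K),
      Module.finrank F K = χ.natDegree ∧ ∃ α : K, aeval α χ = 0 := by
  have : Fact (Irreducible χ) := ⟨h⟩
  let pb := AdjoinRoot.powerBasis h.ne_zero
  have : Module.Finite F (AdjoinRoot χ) := pb.finite
  have : Finite (AdjoinRoot χ) := Module.finite_of_finite F
  let e : Shrink.{0} (AdjoinRoot χ) ≃ₐ[F] AdjoinRoot χ := Shrink.algEquiv.{0} F (AdjoinRoot χ)
  refine ⟨Shrink.{0} (AdjoinRoot χ), inferInstance, inferInstance, ?_,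
    e.symm (AdjoinRoot.root χ), ?_⟩
  · rw [e.toLinearEquiv.finrank_eq, pb.finrank, AdjoinRoot.powerBasis_dim]
  · rw [aeval_algHom_apply]
    simp

/-- `Ψ = [M]` acts transitively on `ℙⁿ` iff the characteristic polynomial of `M` is
projectively primitive. -/
theorem statement4 {F : Type*} [Field F] [Fintype F] (n : ℕ) (hn : 1 ≤ n)
    (M : (Fin (n + 1) → F) ≃ₗ[F] (Fin (n + 1) → F)) :
    IsTransitiveMap (projMap M) ↔
      ProjectivelyPrimitive (LinearMap.charpoly M.toLinearMap) := by
  rw [isTransitiveMap_projMap_iff]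
  have finiteK {K : Type} [Field K] [Algebra F K]
      (hK : Module.finrank F K = M.toLinearMap.charpoly.natDegree) : Finite K := by
    have : 0 < Module.finrank F K := by
      rw [hK, LinearMap.charpoly_natDegree]
      exact Module.finrank_pos
    have : Module.Finite F K := Module.finite_of_finrank_pos this
    exact Module.finite_of_finite F
  constructor
  · intro h
    have hirr := irreducible_charpoly_of_forall_exists_smul_pow _ h
    refine ⟨hirr, fun K _ _ hK α hα => ?_⟩
    have := finiteK hK
    exact (zpowers_mk_eq_top_iff α).mpr ((forall_exists_smul_pow_iff _ hirr hK hα).mp h)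
  · rintro ⟨hirr, h⟩
    obtain ⟨K, _, _, hK, α, hα⟩ := exists_root_in_type hirr
    have := finiteK hK
    have hα0 : α ≠ 0 := by
      rintro rfl
      have hdet : LinearMap.det M.toLinearMap ≠ 0 := M.isUnit_det'.ne_zero
      rw [LinearMap.det_eq_sign_charpoly_coeff] at hdet
      rw [← coeff_zero_eq_aeval_zero'] at hα
      exact hdet (by rw [(map_eq_zero _).mp hα, mul_zero])
    exact (forall_exists_smul_pow_iff _ hirr hK hα).mpr
      ((zpowers_mk_eq_top_iff (Units.mk0 α hα0)).mp (h K hK (Units.mk0 α hα0) hα))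
end

section
/- Let Ψ be a transitive automorphism of ℙⁿ over F_q. Then for every P ∈ U the fractional jump index 𝔍_P = min{k ≥ 1 : Ψ^k(P) ∈ U} satisfies 𝔍_P ≤ n+1; that is, for every P ∈ U there exists k with 1 ≤ k ≤ n+1 and Ψ^k(P) ∈ U. -/
open Polynomial

/-- If a linear functional vanishes on the first `finrank K V` iterates of a vector under an
endomorphism, then it vanishes on all of them. -/
theorem functional_pow_apply_eq_zero {K V : Type*} [Field K] [AddCommGroup V] [Module K V]
    [FiniteDimensional K V] (f : Module.End K V) (φ : Module.Dual K V) (w : V)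
    (h : ∀ i < Module.finrank K V, φ ((f ^ i) w) = 0) (j : ℕ) : φ ((f ^ j) w) = 0 := by
  rcases Nat.eq_zero_or_pos (Module.finrank K V) with h0 | hpos
  · have := Module.finrank_zero_iff.mp h0
    rw [Subsingleton.elim ((f ^ j) w) 0, map_zero]
  have hdeg : (X ^ j %ₘ f.charpoly).natDegree < Module.finrank K V := by
    rw [← f.charpoly_natDegree]
    refine natDegree_modByMonic_lt _ f.charpoly_monic fun h1 => ?_
    have := f.charpoly_natDegree
    rw [h1, natDegree_one] at this
    omega
  rw [LinearMap.pow_eq_aeval_mod_charpoly, aeval_eq_sum_range' hdeg, LinearMap.sum_apply, map_sum]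
  refine Finset.sum_eq_zero fun i hi => ?_
  rw [LinearMap.smul_apply, map_smul, h i (Finset.mem_range.mp hi), smul_zero]

theorem inU_projMap_iterate_iff {F : Type*} [Field F] {n : ℕ}
    (M : (Fin (n + 1) → F) ≃ₗ[F] (Fin (n + 1) → F)) (k : ℕ)
    (P : Projectivization F (Fin (n + 1) → F)) :
    inU ((projMap M)^[k] P) ↔ (M.toLinearMap ^ k) P.rep (Fin.last n) ≠ 0 := by
  induction k generalizing P with
  | zero => rfl
  | succ k ih =>
    obtain ⟨v, hv, rfl⟩ : ∃ v hv, P = Projectivization.mk F v hv :=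
      ⟨_, P.rep_nonzero, P.mk_rep.symm⟩
    have hMv : M v ≠ 0 := by simpa using hv
    obtain ⟨a, ha⟩ := Projectivization.exists_smul_eq_mk_rep F v hv
    obtain ⟨b, hb⟩ := Projectivization.exists_smul_eq_mk_rep F (M v) hMv
    have hmap : projMap M (Projectivization.mk F v hv) = Projectivization.mk F (M v) hMv := rfl
    rw [Function.iterate_succ_apply, ih, hmap, ← ha, ← hb, pow_succ]
    simp [Units.smul_def]

/-- If `Ψ` is a transitive automorphism of `ℙⁿ`, then for every `P ∈ U` the fractional jump
index is at most `n + 1`: there is `k` with `1 ≤ k ≤ n + 1` and `Ψ^k(P) ∈ U`. -/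
theorem statement8 {F : Type*} [Field F] [Fintype F] (n : ℕ) (hn : 1 ≤ n)
    (M : (Fin (n + 1) → F) ≃ₗ[F] (Fin (n + 1) → F))
    (hM : IsTransitiveMap (projMap M))
    (P : Projectivization F (Fin (n + 1) → F)) (hP : inU P) :
    ∃ k : ℕ, 1 ≤ k ∧ k ≤ n + 1 ∧ inU ((projMap M)^[k] P) := by
  by_contra! hcon
  simp only [inU_projMap_iterate_iff, not_not] at hcon
  obtain ⟨i, hi⟩ := hM (projMap M P) P
  rw [← Function.iterate_succ_apply] at hi
  rw [← hi, inU_projMap_iterate_iff, pow_succ] at hP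
  refine hP (functional_pow_apply_eq_zero M.toLinearMap (LinearMap.proj (Fin.last n)) (M P.rep)
    (fun j hj => ?_) i)
  have := hcon (j + 1) (by omega) (by simpa using hj)
  rwa [pow_succ] at this
end

section
/- Let Ψ be an automorphism of ℙⁿ over F_q with fractional jump indices 𝔍_P, and let 𝔍 = max{𝔍_P : P ∈ U} be the absolute fractional jump index of Ψ. For i ≥ 1 let V_i = {x ∈ F_qⁿ : Ψ^k(π(x)) ∈ H for all k ∈ {1,…,i}} and V_0 = F_qⁿ. Then min{i ∈ ℕ : V_i = ∅} = 𝔍. -/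
open Polynomial

theorem inU_mk {F : Type*} [Field F] {n : ℕ} (v : Fin (n + 1) → F) (hv : v ≠ 0) :
    inU (Projectivization.mk F v hv) ↔ v (Fin.last n) ≠ 0 := by
  obtain ⟨a, ha⟩ := Projectivization.exists_smul_eq_mk_rep F v hv
  simp [inU, ← ha, Units.smul_def]

theorem exists_toProj_eq {F : Type*} [Field F] {n : ℕ}
    {P : Projectivization F (Fin (n + 1) → F)} (hP : inU P) : ∃ x, toProj x = P := by
  refine ⟨toAff P, ?_⟩
  rw [← P.mk_rep, toProj, Projectivization.mk_eq_mk_iff', P.mk_rep]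
  refine ⟨(P.rep (Fin.last n))⁻¹, ?_⟩
  have h : P.rep (Fin.last n) ≠ 0 := hP
  ext i
  refine Fin.lastCases ?_ (fun i => ?_) i
  · simp [h]
  · simp [toAff, div_eq_inv_mul]

theorem projMap_injective {F : Type*} [Field F] {n : ℕ}
    (M : (Fin (n + 1) → F) ≃ₗ[F] (Fin (n + 1) → F)) : Function.Injective (projMap M) :=
  Projectivization.map_injective M.toLinearMap M.injective

theorem exists_pos_inU_iterate {F : Type*} [Field F] [Finite F] {n : ℕ}
    (M : (Fin (n + 1) → F) ≃ₗ[F] (Fin (n + 1) → F))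
    {P : Projectivization F (Fin (n + 1) → F)} (hP : inU P) :
    ∃ k, 1 ≤ k ∧ inU ((projMap M)^[k] P) := by
  obtain ⟨k, hk, h⟩ := (projMap_injective M).mem_periodicPts P
  exact ⟨k, hk, h.eq.symm ▸ hP⟩

theorem jumpIndex_le_iff {F : Type*} [Field F] [Finite F] {n : ℕ}
    (M : (Fin (n + 1) → F) ≃ₗ[F] (Fin (n + 1) → F))
    {P : Projectivization F (Fin (n + 1) → F)} (hP : inU P) (i : ℕ) :
    jumpIndex (projMap M) P ≤ i ↔ ∃ k, 1 ≤ k ∧ k ≤ i ∧ inU ((projMap M)^[k] P) := by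
  constructor
  · intro h
    have hmem := Nat.sInf_mem (exists_pos_inU_iterate M hP)
    exact ⟨_, hmem.1, h, hmem.2⟩
  · rintro ⟨k, hk, hki, hU⟩
    exact le_trans (Nat.sInf_le (And.intro hk hU)) hki

/-- The least `i` such that `Vᵢ = {x : Ψ^k(π(x)) ∈ H for all 1 ≤ k ≤ i}` is empty equals the
absolute fractional jump index `𝔍 = max{𝔍_P : P ∈ U}` of `Ψ`. -/
theorem statement9 {F : Type*} [Field F] [Fintype F] (n : ℕ) (hn : 1 ≤ n)
    (M : (Fin (n + 1) → F) ≃ₗ[F] (Fin (n + 1) → F)) :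
    sInf {i : ℕ |
        {x : Fin n → F | ∀ k : ℕ, 1 ≤ k → k ≤ i → ¬ inU ((projMap M)^[k] (toProj x))} = ∅} =
      sSup (jumpIndex (projMap M) '' {P | inU P}) := by
  have hset : {i : ℕ | {x : Fin n → F | ∀ k : ℕ, 1 ≤ k → k ≤ i →
      ¬ inU ((projMap M)^[k] (toProj x))} = ∅} =
      upperBounds (jumpIndex (projMap M) '' {P | inU P}) := by
    ext i
    simp only [Set.mem_ofPred_eq, Set.eq_empty_iff_forall_notMem, mem_upperBounds,
      Set.forall_mem_image]
    constructor
    · intro h P hP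
      obtain ⟨x, rfl⟩ := exists_toProj_eq hP
      rw [jumpIndex_le_iff M hP]
      have hx := h x
      push Not at hx
      exact hx
    · intro h x hx
      obtain ⟨k, hk, hki, hU⟩ := (jumpIndex_le_iff M (inU_toProj x) i).1 (h (inU_toProj x))
      exact hx k hk hki hU
  rw [hset]
  exact csInf_upperBounds_eq_csSup (Set.toFinite _).bddAbove
    ⟨_, Set.mem_image_of_mem _ (inU_toProj 0)⟩
end

section
/- Let p be a prime, n ≥ 1, and let M ∈ GL_{n+1}(F_p) have projectively primitive characteristic polynomial. Then for every integer i with 1 ≤ i ≤ p−1, the matrix M^i leaves invariant no F_p-linear subspace W of F_p^{n+1} with 0 < dim W < n+1; that is, there is no proper nonzero subspace W with M^i·W = W. -/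
open Polynomial

/-- If the invertible `α` generates `Kˣ` modulo scalars, `K` acts on `V`, and `α ^ i` preserves a
subspace `W`, then every `i`-th power of a unit preserves `W`. -/
lemma pow_smul_mem_of_generates {F K V : Type*} [Field F] [Field K] [Algebra F K] [Finite K]
    [AddCommGroup V] [Module F V] (φ : K →ₐ[F] Module.End F V) (α : Kˣ)
    (hα : Subgroup.zpowers
      (QuotientGroup.mk (s := (Units.map (algebraMap F K).toMonoidHom).range) α) = ⊤)
    (i : ℕ) (W : Submodule F V) (hW : ∀ w ∈ W, φ ((α : K) ^ i) w ∈ W) (x : Kˣ)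
    {w : V} (hw : w ∈ W) : φ ((x : K) ^ i) w ∈ W := by
  have hx : (QuotientGroup.mk x : Kˣ ⧸ (Units.map (algebraMap F K).toMonoidHom).range) ∈
      Subgroup.zpowers (QuotientGroup.mk α) := hα ▸ Subgroup.mem_top _
  rw [← mem_powers_iff_mem_zpowers] at hx
  obtain ⟨j, hj⟩ := hx
  have hj' : (QuotientGroup.mk (α ^ j) :
      Kˣ ⧸ (Units.map (algebraMap F K).toMonoidHom).range) = QuotientGroup.mk x := hj
  rw [QuotientGroup.eq] at hj'
  obtain ⟨c, hc⟩ := hj'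
  have hxc : (x : K) = (α : K) ^ j * algebraMap F K c := by
    have h : x = α ^ j * Units.map (algebraMap F K).toMonoidHom c := by
      rw [hc, mul_inv_cancel_left]
    simpa using congrArg Units.val h
  have hpow : ∀ k : ℕ, φ (((α : K) ^ i) ^ k) w ∈ W := by
    intro k
    induction k with
    | zero => simpa using hw
    | succ k ih =>
      rw [pow_succ', map_mul]
      exact hW _ ih
  have h : (x : K) ^ i = algebraMap F K ((c : F) ^ i) * ((α : K) ^ i) ^ j := by
    rw [hxc, map_pow]
    ring
  rw [h, map_mul, AlgHom.commutes]
  exact W.smul_mem _ (hpow j)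

/-- If `K` is a finite field acting on `V`, then a subspace containing the images of a nonzero
vector `w` under all `i`-th powers of units of `K` has at least `(|K| - 1) / i` nonzero elements. -/
lemma card_units_le_mul_card_submodule {F K V : Type*} [Field F] [Field K] [Algebra F K]
    [Finite K] [AddCommGroup V] [Module F V] [Finite V] (φ : K →ₐ[F] Module.End F V)
    (i : ℕ) (hi : 1 ≤ i) (W : Submodule F V) {w : V} (hw0 : w ≠ 0)
    (hW : ∀ x : Kˣ, φ ((x : K) ^ i) w ∈ W) :
    Nat.card K - 1 ≤ i * (Nat.card W - 1) := by
  classical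
  have := Fintype.ofFinite K
  have := Fintype.ofFinite V
  have hinj : ∀ x : K, φ x w = 0 → x = 0 := by
    intro x hx
    by_contra hx0
    apply hw0
    have h : φ (x⁻¹ * x) w = 0 := by simp [map_mul, hx]
    simpa [inv_mul_cancel₀ hx0] using h
  let f : Kˣ → V := fun x => φ ((x : K) ^ i) w
  have hfib : ∀ v ∈ Finset.univ.image f,
      (Finset.univ.filter fun x => f x = v).card ≤ i := by
    intro v hv
    obtain ⟨y, -, rfl⟩ := Finset.mem_image.mp hv
    calc (Finset.univ.filter fun x => f x = f y).card
        ≤ (nthRoots i ((y : K) ^ i)).toFinset.card := by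
          refine Finset.card_le_card_of_injOn (fun x : Kˣ => (x : K)) ?_
            (Units.val_injective.injOn)
          intro x hx
          have hx' : f x = f y := by simpa using hx
          have h : φ ((x : K) ^ i - (y : K) ^ i) w = 0 := by
            rw [map_sub, LinearMap.sub_apply]
            exact sub_eq_zero.mpr hx'
          simpa [mem_nthRoots hi] using sub_eq_zero.mp (hinj _ h)
      _ ≤ (nthRoots i ((y : K) ^ i)).card := Multiset.toFinset_card_le _
      _ ≤ i := card_nthRoots _ _
  have hcard := Finset.card_le_mul_card_image Finset.univ i hfib
  have himage : Finset.univ.image f ⊆ (Finset.univ.filter (· ∈ W)).erase 0 := by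
    intro v hv
    obtain ⟨x, -, rfl⟩ := Finset.mem_image.mp hv
    simp only [Finset.mem_erase, Finset.mem_filter, Finset.mem_univ, true_and]
    exact ⟨fun h => pow_ne_zero i x.ne_zero (hinj _ h), hW x⟩
  have hle := Finset.card_le_card himage
  rw [Finset.card_erase_of_mem (by simp)] at hle
  have hWcard : (Finset.univ.filter (· ∈ W)).card = Nat.card W := by
    rw [Nat.card_eq_fintype_card, Fintype.card_subtype]
  rw [hWcard] at hle
  rw [Finset.card_univ, Fintype.card_units, ← Nat.card_eq_fintype_card] at hcard
  exact hcard.trans (Nat.mul_le_mul_left i hle)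

/-- If `M ∈ GL_{n+1}(F_p)` has projectively primitive characteristic polynomial, then for
`1 ≤ i ≤ p - 1` the matrix `M^i` leaves invariant no proper nonzero linear subspace of
`F_p^{n+1}`. -/
theorem statement11 (p : ℕ) [Fact p.Prime] (n : ℕ) (hn : 1 ≤ n)
    (M : (Fin (n + 1) → ZMod p) ≃ₗ[ZMod p] (Fin (n + 1) → ZMod p))
    (hχ : ProjectivelyPrimitive (LinearMap.charpoly M.toLinearMap))
    (i : ℕ) (hi1 : 1 ≤ i) (hi2 : i ≤ p - 1) :
    ¬ ∃ W : Submodule (ZMod p) (Fin (n + 1) → ZMod p),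
        W ≠ ⊥ ∧ W ≠ ⊤ ∧ W.map (M ^ i).toLinearMap = W := by
  rintro ⟨W, hbot, htop, hmap⟩
  obtain ⟨hirr, hgen⟩ := hχ
  set χ := LinearMap.charpoly M.toLinearMap with hχ
  have : Fact (Irreducible χ) := ⟨hirr⟩
  have hdeg : χ.natDegree = n + 1 := by
    rw [hχ, LinearMap.charpoly_natDegree, Module.finrank_fin_fun]
  let B := AdjoinRoot.powerBasis hirr.ne_zero
  have hfin : Module.finrank (ZMod p) (AdjoinRoot χ) = χ.natDegree := by
    rw [B.finrank, AdjoinRoot.powerBasis_dim]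
  have : Module.Finite (ZMod p) (AdjoinRoot χ) := B.finite
  have : Finite (AdjoinRoot χ) := Module.finite_of_finite (ZMod p)
  let φ : AdjoinRoot χ →ₐ[ZMod p] Module.End (ZMod p) (Fin (n + 1) → ZMod p) :=
    Ideal.Quotient.liftₐ (Ideal.span {χ}) (aeval M.toLinearMap) fun a ha => by
      obtain ⟨b, rfl⟩ := Ideal.mem_span_singleton.mp ha
      rw [map_mul, LinearMap.aeval_self_charpoly, zero_mul]
  have hφ : φ (AdjoinRoot.root χ) = M.toLinearMap := aeval_X _
  obtain ⟨w, hw, hw0⟩ := W.ne_bot_iff.mp hbot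
  have hroot : AdjoinRoot.root χ ≠ 0 := by
    intro h
    rw [h, map_zero] at hφ
    exact hw0 (M.map_eq_zero_iff.mp (LinearMap.congr_fun hφ w).symm)
  have hα := hgen (AdjoinRoot χ) hfin (Units.mk0 _ hroot)
    ((AdjoinRoot.aeval_eq χ).trans AdjoinRoot.mk_self)
  have hpow : (M ^ i).toLinearMap = M.toLinearMap ^ i :=
    map_pow (LinearEquiv.automorphismGroup.toLinearMapMonoidHom (R := ZMod p)
      (M := Fin (n + 1) → ZMod p)) M i
  have hinv : ∀ v ∈ W, φ (AdjoinRoot.root χ ^ i) v ∈ W := by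
    intro v hv
    rw [map_pow, hφ, ← hpow, ← hmap]
    exact Submodule.mem_map_of_mem hv
  have hcard := card_units_le_mul_card_submodule φ i hi1 W hw0
    fun x => pow_smul_mem_of_generates φ _ hα i W hinv x hw
  have hlt := Submodule.finrank_lt htop
  rw [Module.finrank_fin_fun] at hlt
  rw [Module.natCard_eq_pow_finrank (K := ZMod p) (V := AdjoinRoot χ),
    Module.natCard_eq_pow_finrank (K := ZMod p) (V := W),
    hfin, hdeg, Nat.card_zmod] at hcard
  have hp := (Fact.out : p.Prime).two_le
  have hle : p ^ Module.finrank (ZMod p) W ≤ p ^ n := Nat.pow_le_pow_right (by omega) (by omega)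
  have hpn : 2 ≤ p ^ n := hp.trans (Nat.le_self_pow (by omega) p)
  have hmul : i * (p ^ Module.finrank (ZMod p) W - 1) ≤ (p - 1) * (p ^ n - 1) := by gcongr
  obtain ⟨q, rfl⟩ : ∃ q, p = q + 1 := ⟨p - 1, by omega⟩
  obtain ⟨r, hr⟩ : ∃ r, (q + 1) ^ n = r + 1 := ⟨(q + 1) ^ n - 1, by omega⟩
  rw [pow_succ, hr] at hcard
  rw [hr] at hmul
  simp only [Nat.add_sub_cancel] at hmul
  have h : (r + 1) * (q + 1) - 1 = q * r + r + q := by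
    rw [show (r + 1) * (q + 1) = q * r + r + q + 1 by ring, Nat.add_sub_cancel]
  omega
end
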